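/- arXiv:2109.11671 — 2 statements merged into one kernel-verified Lean document; each statement's English description precedes it below -/
import Mathlib

section
/- Let k ∈ ℕ, let (V, C, e) and (W, D, f) be k-AOU spaces, and let φ: V → W be a k-positive linear map (φ_k(C) ⊆ D). Then for every extension {𝒞_n} of C, the map φ is completely positive from the operator system (V, {𝒞_n}, e) to W_{k-min} = (W, {D_n^{k-min}}, f); that is, φ_n(𝒞_n) ⊆ D_n^{k-min} for every n ∈ ℕ. -/
open scoped ComplexConjugate ComplexOrder

noncomputable section

universe u v

/-- The diagonal matrix `I_n ⊗ e` in `M_n(V)`. -/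
def unitMat {V : Type u} [AddCommGroup V] (n : ℕ) (e : V) : Matrix (Fin n) (Fin n) V :=
  Matrix.of fun i j => if i = j then e else 0

/-- The conjugation `α* x α ∈ M_m(V)` of `x ∈ M_n(V)` by a scalar matrix `α ∈ M_{n,m}(ℂ)`. -/
def conjAct {V : Type u} [AddCommGroup V] [Module ℂ V] {n m : ℕ}
    (α : Matrix (Fin n) (Fin m) ℂ) (x : Matrix (Fin n) (Fin n) V) :
    Matrix (Fin m) (Fin m) V :=
  Matrix.of fun i j => ∑ p : Fin n, ∑ q : Fin n, (conj (α p i) * α q j) • x p q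

section Defs

variable {V : Type u} [AddCommGroup V] [Module ℂ V] [StarAddMonoid V] [StarModule ℂ V]

/-- `(V, C, e)` is a `k`-AOU space. -/
structure IsKAOU (k : ℕ) (C : Set (Matrix (Fin k) (Fin k) V)) (e : V) : Prop where
  herm : ∀ x ∈ C, star x = x
  add_mem : ∀ x ∈ C, ∀ y ∈ C, x + y ∈ C
  smul_mem : ∀ r : ℝ, 0 ≤ r → ∀ x ∈ C, (r : ℂ) • x ∈ C
  proper : ∀ x ∈ C, -x ∈ C → x = 0
  compat : ∀ α : Matrix (Fin k) (Fin k) ℂ, ∀ x ∈ C, conjAct α x ∈ C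
  orderUnit : ∀ x : Matrix (Fin k) (Fin k) V, star x = x →
    ∃ r : ℝ, 0 < r ∧ (r : ℂ) • unitMat k e - x ∈ C
  arch : ∀ x : Matrix (Fin k) (Fin k) V,
    (∀ r : ℝ, 0 < r → x + (r : ℂ) • unitMat k e ∈ C) → x ∈ C

/-- A matrix ordering on the `*`-vector space `V`. -/
structure IsMatrixOrdering (C : ∀ n : ℕ, Set (Matrix (Fin n) (Fin n) V)) : Prop where
  herm : ∀ n, ∀ x ∈ C n, star x = x
  add_mem : ∀ n, ∀ x ∈ C n, ∀ y ∈ C n, x + y ∈ C n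
  smul_mem : ∀ n, ∀ r : ℝ, 0 ≤ r → ∀ x ∈ C n, (r : ℂ) • x ∈ C n
  proper : ∀ n, ∀ x ∈ C n, -x ∈ C n → x = 0
  compat : ∀ n m : ℕ, ∀ α : Matrix (Fin n) (Fin m) ℂ, ∀ x ∈ C n, conjAct α x ∈ C m

/-- `(V, {C_n}, e)` is an (abstract) operator system. -/
structure IsOperatorSystem (C : ∀ n : ℕ, Set (Matrix (Fin n) (Fin n) V)) (e : V)
    extends IsMatrixOrdering C : Prop where
  orderUnit : ∀ n : ℕ, ∀ x : Matrix (Fin n) (Fin n) V, star x = x →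
    ∃ r : ℝ, 0 < r ∧ (r : ℂ) • unitMat n e - x ∈ C n
  arch : ∀ n : ℕ, ∀ x : Matrix (Fin n) (Fin n) V,
    (∀ r : ℝ, 0 < r → x + (r : ℂ) • unitMat n e ∈ C n) → x ∈ C n

/-- The cones `C_n^{k-min}` associated to a `k`-AOU space `(V, C, e)`. -/
def kMinCone (k : ℕ) (C : Set (Matrix (Fin k) (Fin k) V)) (n : ℕ) :
    Set (Matrix (Fin n) (Fin n) V) :=
  {x | star x = x ∧ ∀ α : Matrix (Fin n) (Fin k) ℂ, conjAct α x ∈ C}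

/-- `{𝒞_n}` is an extension of the `k`-AOU space `(V, C, e)`: a matrix ordering with
`𝒞_k = C` making `(V, {𝒞_n}, e)` an operator system. -/
def IsExtension (k : ℕ) (C : Set (Matrix (Fin k) (Fin k) V)) (e : V)
    (𝒞 : ∀ n : ℕ, Set (Matrix (Fin n) (Fin n) V)) : Prop :=
  IsOperatorSystem 𝒞 e ∧ 𝒞 k = C

end Defs

theorem conjAct_map {V : Type u} {W : Type v} [AddCommGroup V] [Module ℂ V]
    [AddCommGroup W] [Module ℂ W] (φ : V →ₗ[ℂ] W) {n m : ℕ}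
    (α : Matrix (Fin n) (Fin m) ℂ) (x : Matrix (Fin n) (Fin n) V) :
    conjAct α (x.map ⇑φ) = (conjAct α x).map ⇑φ := by
  ext i j
  simp [conjAct, map_sum, map_smul]

theorem star_unitMat {V : Type u} [AddCommGroup V] [StarAddMonoid V] (n : ℕ) (v : V) :
    star (unitMat n v) = unitMat n (star v) := by
  ext i j
  by_cases h : i = j
  · simp [unitMat, Matrix.star_apply, h]
  · simp [unitMat, Matrix.star_apply, h, Ne.symm h]

/-- Every hermitian element of a `k`-AOU space is a difference of two positive elements. -/
theorem IsKAOU.exists_sub {V : Type u} [AddCommGroup V] [Module ℂ V] [StarAddMonoid V]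
    [StarModule ℂ V] {k : ℕ} {C : Set (Matrix (Fin k) (Fin k) V)} {e : V} (hC : IsKAOU k C e)
    {x : Matrix (Fin k) (Fin k) V} (hx : star x = x) :
    ∃ y ∈ C, ∃ z ∈ C, x = y - z := by
  obtain ⟨r, hr, hrx⟩ := hC.orderUnit x hx
  obtain ⟨s, hs, hs0⟩ := hC.orderUnit 0 (star_zero _)
  have hsum := hC.smul_mem (r / s) (by positivity) _ hs0
  have hsc : (s : ℂ) ≠ 0 := by exact_mod_cast hs.ne'
  have hre : (r : ℂ) • unitMat k e ∈ C := by
    rwa [sub_zero, smul_smul, Complex.ofReal_div, div_mul_cancel₀ _ hsc] at hsum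
  exact ⟨_, hre, _, hrx, by abel⟩

/-- A `k`-positive map between `k`-AOU spaces preserves the involution. -/
theorem IsKAOU.map_star {V : Type u} {W : Type v}
    [AddCommGroup V] [Module ℂ V] [StarAddMonoid V] [StarModule ℂ V]
    [AddCommGroup W] [Module ℂ W] [StarAddMonoid W] [StarModule ℂ W]
    {k : ℕ} (hk : 0 < k)
    {C : Set (Matrix (Fin k) (Fin k) V)} {e : V} (hC : IsKAOU k C e)
    {D : Set (Matrix (Fin k) (Fin k) W)} {f : W} (hD : IsKAOU k D f)
    (φ : V →ₗ[ℂ] W) (hφ : ∀ x ∈ C, x.map ⇑φ ∈ D) (v : V) :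
    φ (star v) = star (φ v) := by
  have key : ∀ a : V, star a = a → star (φ a) = φ a := by
    intro a ha
    obtain ⟨y, hy, z, hz, hyz⟩ := hC.exists_sub (x := unitMat k a) (by rw [star_unitMat, ha])
    let i : Fin k := ⟨0, hk⟩
    have hyi : star (φ (y i i)) = φ (y i i) := congrFun (congrFun (hD.herm _ (hφ y hy)) i) i
    have hzi : star (φ (z i i)) = φ (z i i) := congrFun (congrFun (hD.herm _ (hφ z hz)) i) i
    have hai : a = y i i - z i i := by simpa [unitMat] using congrFun (congrFun hyz i) i
    rw [hai, map_sub, star_sub, hyi, hzi]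
  have hre := (realPart v).2.star_eq
  have him := (imaginaryPart v).2.star_eq
  rw [← realPart_add_I_smul_imaginaryPart v]
  simp only [star_add, star_smul, map_add, map_smul, hre, him, key _ hre, key _ him]

/-- A `k`-positive map `φ : (V, C, e) → (W, D, f)` between `k`-AOU spaces is
completely positive from any operator system structure on `V` into `W_{k-min}`. -/
theorem stmt_3 {V : Type u} {W : Type v}
    [AddCommGroup V] [Module ℂ V] [StarAddMonoid V] [StarModule ℂ V]
    [AddCommGroup W] [Module ℂ W] [StarAddMonoid W] [StarModule ℂ W]
    (k : ℕ) (hk : 0 < k)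
    (C : Set (Matrix (Fin k) (Fin k) V)) (e : V) (hC : IsKAOU k C e)
    (D : Set (Matrix (Fin k) (Fin k) W)) (f : W) (hD : IsKAOU k D f)
    (φ : V →ₗ[ℂ] W) (hφ : ∀ x ∈ C, x.map ⇑φ ∈ D)
    (𝒞 : ∀ n : ℕ, Set (Matrix (Fin n) (Fin n) V)) (h𝒞 : IsExtension k C e 𝒞) :
    ∀ n : ℕ, ∀ x ∈ 𝒞 n, x.map ⇑φ ∈ kMinCone k D n := by
  intro n x hx
  obtain ⟨hS, hk𝒞⟩ := h𝒞
  refine ⟨?_, fun α => ?_⟩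
  · ext i j
    have hij : star (x j i) = x i j := congrFun (congrFun (hS.herm n x hx) i) j
    rw [Matrix.star_apply, Matrix.map_apply, Matrix.map_apply,
      ← hC.map_star hk hD φ hφ, hij]
  · rw [conjAct_map]
    exact hφ _ (hk𝒞 ▸ hS.compat n k α x hx)
end
end

section
/- Let k ∈ ℕ, let (V, C, e) be a k-AOU space, let n ∈ ℕ, and let x ∈ M_n(V) be hermitian. Then the following are equivalent: (1) x ∈ C_n^{k-min}; (2) φ_n(x) is positive semidefinite in M_n(M_k(ℂ)) ≅ M_{nk}(ℂ) for every k-state φ on V (every unital k-positive linear map φ: V → M_k(ℂ)); (3) ψ_n(x) is positive semidefinite in M_{nk}(ℂ) for every k-positive linear map ψ: V → M_k(ℂ). -/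
open scoped ComplexConjugate ComplexOrder

noncomputable section

universe u v

/-- Flatten a matrix of matrices `M_n(M_k(ℂ))` into a matrix `M_{nk}(ℂ)`. -/
def flattenM {n k : ℕ} (x : Matrix (Fin n) (Fin n) (Matrix (Fin k) (Fin k) ℂ)) :
    Matrix (Fin n × Fin k) (Fin n × Fin k) ℂ :=
  Matrix.of fun p q => x p.1 q.1 p.2 q.2

/-- A linear map `ψ : V → M_k(ℂ)` is `k`-positive (for the `k`-AOU space `(V, C, e)` and the
`k`-AOU structure on `M_k(ℂ)` given by positive semidefinite matrices). -/
def IsKPosToMk {V : Type u} [AddCommGroup V] [Module ℂ V] [StarAddMonoid V] [StarModule ℂ V]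
    (k : ℕ) (C : Set (Matrix (Fin k) (Fin k) V))
    (ψ : V →ₗ[ℂ] Matrix (Fin k) (Fin k) ℂ) : Prop :=
  ∀ x ∈ C, (flattenM (x.map ⇑ψ)).PosSemidef

/-- If `y + δ u` lies outside a cone with order unit `u`, then some positive normalised
functional is negative at `y`. -/
theorem exists_positive_functional_neg {E : Type*} [AddCommGroup E] [Module ℝ E]
    (s : PointedCone ℝ E) (u y : E) (hu : ∀ z, ∃ r : ℝ, 0 < r ∧ r • u + z ∈ s)
    (hus : u ∈ s) (δ : ℝ) (hδ : 0 < δ) (hy : y + δ • u ∉ s) :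
    ∃ g : E →ₗ[ℝ] ℝ, (∀ z ∈ s, 0 ≤ g z) ∧ g u = 1 ∧ g y < 0 := by
  have smul_mem : ∀ (r : ℝ), 0 ≤ r → ∀ z ∈ s, r • z ∈ s := fun r hr z hz =>
    s.smul_mem hr hz
  have neg_unit : -u ∉ s := fun h => hy <| by
    obtain ⟨r, hr, hz⟩ := hu (y + δ • u)
    have := s.add_mem hz (smul_mem r hr.le _ h)
    rwa [show r • u + (y + δ • u) + r • -u = y + δ • u by module] at this
  have neg_smul_unit : ∀ t : ℝ, t < 0 → t • u ∉ s := fun t ht h => neg_unit <| by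
    have := smul_mem (-t)⁻¹ (by simpa using ht.le) _ h
    rwa [smul_smul, inv_neg, neg_mul, inv_mul_cancel₀ ht.ne, neg_one_smul] at this
  have u_ne : u ≠ 0 := fun h => neg_unit <| by simp [h]
  let s' : PointedCone ℝ E :=
    { carrier := {z | ∃ l : ℝ, 0 ≤ l ∧ z + l • (y + δ • u) ∈ s}
      add_mem' := by
        rintro a b ⟨l, hl, ha⟩ ⟨m, hm, hb⟩
        refine ⟨l + m, add_nonneg hl hm, ?_⟩
        have := s.add_mem ha hb
        rwa [show a + l • (y + δ • u) + (b + m • (y + δ • u))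
          = a + b + (l + m) • (y + δ • u) by module] at this
      zero_mem' := ⟨0, le_rfl, by simp⟩
      smul_mem' := by
        rintro ⟨c, hc⟩ a ⟨l, hl, ha⟩
        refine ⟨c * l, mul_nonneg hc hl, ?_⟩
        have := smul_mem c hc _ ha
        rw [show c • (a + l • (y + δ • u)) = c • a + (c * l) • (y + δ • u) by module] at this
        exact this }
  obtain ⟨g, hg, hgs⟩ := riesz_extension s' (LinearPMap.mkSpanSingleton u (1 : ℝ) u_ne) (by
      rintro ⟨z, hz⟩ hzs
      obtain ⟨t, rfl⟩ := Submodule.mem_span_singleton.1 hz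
      rw [LinearPMap.mkSpanSingleton'_apply]
      obtain ⟨l, hl, hls⟩ := hzs
      by_contra! ht
      have ht : t < 0 := by simpa using ht
      rcases hl.eq_or_lt with rfl | hl
      · exact neg_smul_unit t ht (by simpa using hls)
      · apply hy
        have h1 := s.add_mem hls (smul_mem (-t) (by linarith) u hus)
        have h2 := smul_mem l⁻¹ (by positivity) _ h1
        rwa [show (t • u + l • (y + δ • u)) + (-t) • u = l • (y + δ • u) by module,
          smul_smul, inv_mul_cancel₀ hl.ne', one_smul] at h2) (by
      intro z
      obtain ⟨r, -, hr⟩ := hu z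
      exact ⟨⟨r • u, Submodule.smul_mem _ _ (Submodule.mem_span_singleton_self u)⟩,
        0, le_rfl, by simpa using hr⟩)
  have hgu : g u = 1 :=
    (hg ⟨u, Submodule.mem_span_singleton_self u⟩).trans
      (LinearPMap.mkSpanSingleton_apply ℝ ℝ u_ne (1 : ℝ))
  refine ⟨g, fun z hz => hgs z ⟨0, le_rfl, by simpa using hz⟩, hgu, ?_⟩
  have h : 0 ≤ g (-(y + δ • u)) := hgs _ ⟨1, zero_le_one, by simp⟩
  simp only [map_neg, map_add, map_smul, hgu, smul_eq_mul] at h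
  linarith

theorem posSemidef_of_forall_dotProduct_nonneg {ι : Type*} [Fintype ι] {M : Matrix ι ι ℂ}
    (h : ∀ w : ι → ℂ, 0 ≤ star w ⬝ᵥ M.mulVec w) : M.PosSemidef := by
  classical
  rw [← Matrix.isPositive_toEuclideanLin_iff, LinearMap.isPositive_iff_complex]
  intro w
  have hw : 0 ≤ inner ℂ (M.toEuclideanLin w) w := by
    rw [← inner_conj_symm, EuclideanSpace.inner_eq_star_dotProduct, dotProduct_comm]
    exact star_nonneg_iff.2 (h w.ofLp)
  exact ⟨Complex.ext rfl (Complex.nonneg_iff.1 hw).2, (Complex.nonneg_iff.1 hw).1⟩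

/-- A hermitian element outside an Archimedean cone is separated from it by a positive normalised
complex-linear functional. -/
theorem exists_positive_complex_functional_neg {E : Type*} [AddCommGroup E] [Module ℂ E]
    [StarAddMonoid E] [StarModule ℂ E] (C : Set E) (herm : ∀ z ∈ C, star z = z)
    (zero_mem : (0 : E) ∈ C) (add_mem : ∀ a ∈ C, ∀ b ∈ C, a + b ∈ C)
    (smul_mem : ∀ r : ℝ, 0 ≤ r → ∀ a ∈ C, (r : ℂ) • a ∈ C) (u y : E) (hu : u ∈ C)
    (orderUnit : ∀ z : E, star z = z → ∃ r : ℝ, 0 < r ∧ (r : ℂ) • u - z ∈ C)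
    (arch : ∀ z : E, (∀ r : ℝ, 0 < r → z + (r : ℂ) • u ∈ C) → z ∈ C)
    (hys : star y = y) (hy : y ∉ C) :
    ∃ f : E →ₗ[ℂ] ℂ, (∀ z ∈ C, 0 ≤ f z) ∧ f u = 1 ∧ (f y).re < 0 := by
  obtain ⟨δ, hδ, hyδ⟩ : ∃ δ : ℝ, 0 < δ ∧ y + (δ : ℂ) • u ∉ C := by
    by_contra! h
    exact hy (arch y h)
  let s : PointedCone ℝ E :=
    { carrier := {z | z + star z ∈ C}
      add_mem' := by
        intro a b ha hb
        have := add_mem _ ha _ hb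
        rwa [show a + star a + (b + star b) = a + b + star (a + b) by rw [star_add]; abel] at this
      zero_mem' := by simpa using zero_mem
      smul_mem' := by
        rintro ⟨c, hc⟩ a ha
        have := smul_mem c hc _ ha
        rw [show (c : ℂ) • (a + star a) = c • a + star (c • a) by
          simp [← Complex.coe_smul]] at this
        exact this }
  have mem_s : ∀ z, z ∈ s ↔ z + star z ∈ C := fun z => Iff.rfl
  have mem_s_of_herm : ∀ z, star z = z → (z ∈ s ↔ z ∈ C) := fun z hz => by
    rw [mem_s, hz]
    refine ⟨fun h => ?_, fun h => add_mem _ h _ h⟩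
    have := smul_mem 2⁻¹ (by norm_num) _ h
    rwa [← two_smul ℂ z, smul_smul, Complex.ofReal_inv, Complex.ofReal_ofNat,
      inv_mul_cancel₀ two_ne_zero, one_smul] at this
  have hus := herm u hu
  obtain ⟨g, hgs, hgu, hgy⟩ := exists_positive_functional_neg s u y (fun z => by
      obtain ⟨r, hr, h⟩ := orderUnit (-(z + star z)) (by simp [add_comm])
      refine ⟨r, hr, ?_⟩
      rw [mem_s]
      have := add_mem _ h _ (smul_mem r hr.le u hu)
      rwa [show (r : ℂ) • u - -(z + star z) + (r : ℂ) • u = r • u + z + star (r • u + z) by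
        simp [← Complex.coe_smul, hus]; abel] at this)
    ((mem_s_of_herm u hus).2 hu) δ hδ (by
      rwa [mem_s_of_herm _ (by simp [← Complex.coe_smul, hus, hys]), ← Complex.coe_smul])
  have g_skew : ∀ z, star z = z → g (Complex.I • z) = 0 := fun z hz => by
    have h1 : Complex.I • z ∈ s := by simpa [mem_s, hz] using zero_mem
    have h2 : -(Complex.I • z) ∈ s := by simpa [mem_s, hz] using zero_mem
    have h3 := hgs _ h2
    rw [map_neg] at h3
    linarith [hgs _ h1]
  have f_herm : ∀ z, star z = z → Module.Dual.extendRCLike (𝕜 := ℂ) g z = (g z : ℂ) :=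
    fun z hz => by
      have h := g_skew z hz
      simp [Module.Dual.extendRCLike_apply, h]
  refine ⟨Module.Dual.extendRCLike g, fun z hz => ?_, ?_, ?_⟩
  · rw [f_herm z (herm z hz)]
    exact_mod_cast hgs z ((mem_s_of_herm z (herm z hz)).2 hz)
  · rw [f_herm u hus, hgu, Complex.ofReal_one]
  · rwa [f_herm y hys, Complex.ofReal_re]

theorem flattenM_conj {V : Type*} {n k : ℕ} (ψ : V → Matrix (Fin k) (Fin k) ℂ)
    (x : Matrix (Fin n) (Fin n) V) (Q : Matrix (Fin k) (Fin k) ℂ) :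
    flattenM (x.map fun v => Q.conjTranspose * ψ v * Q)
      = (Matrix.kronecker (1 : Matrix (Fin n) (Fin n) ℂ) Q).conjTranspose
        * flattenM (x.map ψ) * Matrix.kronecker (1 : Matrix (Fin n) (Fin n) ℂ) Q := by
  ext ⟨p, i⟩ ⟨q, j⟩
  simp only [flattenM, Matrix.mul_apply, Matrix.kronecker, Matrix.kroneckerMap_apply,
    Fintype.sum_prod_type, Matrix.one_apply, Finset.sum_mul, Matrix.of_apply, Matrix.map_apply,
    Matrix.conjTranspose_apply, ite_mul, mul_ite, one_mul, zero_mul, mul_zero, apply_ite star,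
    star_zero]
  simp only [Finset.sum_ite_irrel, Finset.sum_ite_eq', Finset.sum_const_zero, Finset.mem_univ,
    if_true]

section KPositive

variable {V : Type u} [AddCommGroup V] [Module ℂ V]

/-- The linear functional on `M_k(V)` associated with a linear map `V → M_k(ℂ)`. -/
def functionalOfMap {k : ℕ} (ψ : V →ₗ[ℂ] Matrix (Fin k) (Fin k) ℂ)
    (z : Matrix (Fin k) (Fin k) V) : ℂ :=
  ∑ i, ∑ j, ψ (z i j) i j

theorem star_dotProduct_flattenM_mulVec {n k : ℕ} (ψ : V →ₗ[ℂ] Matrix (Fin k) (Fin k) ℂ)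
    (x : Matrix (Fin n) (Fin n) V) (w : Fin n × Fin k → ℂ) :
    star w ⬝ᵥ (flattenM (x.map ψ)).mulVec w
      = functionalOfMap ψ (conjAct (Matrix.of fun p i => w (p, i)) x) := by
  simp only [dotProduct, Matrix.mulVec, flattenM, functionalOfMap, conjAct, Matrix.of_apply,
    Matrix.map_apply, map_sum, map_smul, Matrix.sum_apply, Matrix.smul_apply,
    Fintype.sum_prod_type, Pi.star_apply, Finset.mul_sum, smul_eq_mul]
  rw [Finset.sum_comm]
  refine Finset.sum_congr rfl fun i _ => ?_
  conv_rhs => rw [Finset.sum_comm]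
  refine Finset.sum_congr rfl fun p _ => ?_
  rw [Finset.sum_comm]
  refine Finset.sum_congr rfl fun j _ => Finset.sum_congr rfl fun q _ => ?_
  simp only [RCLike.star_def]
  ring

/-- The linear map `V → M_k(ℂ)` associated with a linear functional on `M_k(V)`. -/
def mapOfFunctional {k : ℕ} (f : Matrix (Fin k) (Fin k) V →ₗ[ℂ] ℂ) :
    V →ₗ[ℂ] Matrix (Fin k) (Fin k) ℂ where
  toFun v := Matrix.of fun i j => f (Matrix.single i j v)
  map_add' v w := by ext i j; simp [Matrix.single_add]
  map_smul' c v := by ext i j; simp [← Matrix.smul_single]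

theorem functionalOfMap_mapOfFunctional {k : ℕ} (f : Matrix (Fin k) (Fin k) V →ₗ[ℂ] ℂ)
    (z : Matrix (Fin k) (Fin k) V) : functionalOfMap (mapOfFunctional f) z = f z := by
  conv_rhs => rw [Matrix.matrix_eq_sum_single z]
  simp [functionalOfMap, mapOfFunctional]

theorem conjAct_one {k : ℕ} (z : Matrix (Fin k) (Fin k) V) :
    conjAct (1 : Matrix (Fin k) (Fin k) ℂ) z = z := by
  ext i j
  simp [conjAct, Matrix.one_apply, ite_smul]

theorem sum_conjAct_single {k : ℕ} (z : Matrix (Fin k) (Fin k) V) :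
    ∑ i, ∑ j, conjAct (Matrix.single i j (1 : ℂ)) z = unitMat k z.trace := by
  ext a b
  simp [conjAct, Matrix.sum_apply, Matrix.single_apply, unitMat, Matrix.trace, ite_and,
    apply_ite (starRingEnd ℂ), ite_smul, eq_comm (a := a)]

variable [StarAddMonoid V]

namespace IsKAOU

variable {k : ℕ} {C : Set (Matrix (Fin k) (Fin k) V)} {e : V}

theorem zero_mem (hC : IsKAOU k C e) : 0 ∈ C := by
  obtain ⟨r, -, h⟩ := hC.orderUnit 0 (star_zero _)
  simpa using hC.smul_mem 0 le_rfl _ h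

theorem unitMat_mem (hC : IsKAOU k C e) : unitMat k e ∈ C := by
  obtain ⟨r, hr, h⟩ := hC.orderUnit 0 (star_zero _)
  have := hC.smul_mem r⁻¹ (by positivity) _ h
  rwa [sub_zero, smul_smul, ← Complex.ofReal_mul, inv_mul_cancel₀ hr.ne', Complex.ofReal_one,
    one_smul] at this

theorem unitMat_trace_mem (hC : IsKAOU k C e) {z : Matrix (Fin k) (Fin k) V} (hz : z ∈ C) :
    unitMat k z.trace ∈ C := by
  rw [← sum_conjAct_single]
  exact Finset.sum_induction _ (· ∈ C) (fun a b ha hb => hC.add_mem a ha b hb) hC.zero_mem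
    fun i _ => Finset.sum_induction _ (· ∈ C) (fun a b ha hb => hC.add_mem a ha b hb) hC.zero_mem
      fun j _ => hC.compat _ z hz

end IsKAOU

variable [StarModule ℂ V]

theorem star_conjAct {n m : ℕ} (α : Matrix (Fin n) (Fin m) ℂ) (x : Matrix (Fin n) (Fin n) V) :
    star (conjAct α x) = conjAct α (star x) := by
  ext i j
  simp only [conjAct, Matrix.star_apply, Matrix.of_apply, star_sum, star_smul]
  rw [Finset.sum_comm]
  simp [mul_comm]

namespace IsKAOU

variable {k : ℕ} {C : Set (Matrix (Fin k) (Fin k) V)} {e : V}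

theorem isKPosToMk_mapOfFunctional (hC : IsKAOU k C e) {f : Matrix (Fin k) (Fin k) V →ₗ[ℂ] ℂ}
    (hf : ∀ z ∈ C, 0 ≤ f z) : IsKPosToMk k C (mapOfFunctional f) := fun z hz =>
  posSemidef_of_forall_dotProduct_nonneg fun w => by
    rw [star_dotProduct_flattenM_mulVec, functionalOfMap_mapOfFunctional]
    exact hf _ (hC.compat _ z hz)

theorem posSemidef_map_unit (hC : IsKAOU k C e) (hk : 0 < k)
    {ψ : V →ₗ[ℂ] Matrix (Fin k) (Fin k) ℂ} (hψ : IsKPosToMk k C ψ) : (ψ e).PosSemidef := by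
  have h := (hψ _ hC.unitMat_mem).submatrix fun i : Fin k => ((⟨0, hk⟩ : Fin k), i)
  convert h using 1
  ext i j
  simp [flattenM, unitMat]

theorem exists_positive_functional_neg (hC : IsKAOU k C e) {y : Matrix (Fin k) (Fin k) V}
    (hys : star y = y) (hy : y ∉ C) :
    ∃ f : Matrix (Fin k) (Fin k) V →ₗ[ℂ] ℂ,
      (∀ z ∈ C, 0 ≤ f z) ∧ f (unitMat k e) = 1 ∧ (f y).re < 0 :=
  exists_positive_complex_functional_neg C hC.herm hC.zero_mem hC.add_mem hC.smul_mem _ y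
    hC.unitMat_mem hC.orderUnit hC.arch hys hy

end IsKAOU

theorem IsKPosToMk.functionalOfMap_nonneg {k : ℕ} {C : Set (Matrix (Fin k) (Fin k) V)}
    {ψ : V →ₗ[ℂ] Matrix (Fin k) (Fin k) ℂ} (hψ : IsKPosToMk k C ψ)
    {z : Matrix (Fin k) (Fin k) V} (hz : z ∈ C) : 0 ≤ functionalOfMap ψ z := by
  have h := (hψ z hz).dotProduct_mulVec_nonneg fun p => (1 : Matrix (Fin k) (Fin k) ℂ) p.1 p.2
  rw [star_dotProduct_flattenM_mulVec] at h
  have h1 : (Matrix.of fun p i => (1 : Matrix (Fin k) (Fin k) ℂ) p i) = 1 := rfl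
  rwa [h1, conjAct_one] at h

theorem posSemidef_flattenM_of_mem_kMinCone {k n : ℕ} {C : Set (Matrix (Fin k) (Fin k) V)}
    {x : Matrix (Fin n) (Fin n) V} (hx : x ∈ kMinCone k C n)
    {ψ : V →ₗ[ℂ] Matrix (Fin k) (Fin k) ℂ} (hψ : IsKPosToMk k C ψ) :
    (flattenM (x.map ψ)).PosSemidef :=
  posSemidef_of_forall_dotProduct_nonneg fun w => by
    rw [star_dotProduct_flattenM_mulVec]
    exact hψ.functionalOfMap_nonneg (hx.2 _)

open scoped MatrixOrder Matrix.Norms.L2Operator in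
/-- Positivity under all `k`-states gives positivity under every `k`-positive map whose value at
the unit is positive definite. -/
theorem posSemidef_flattenM_of_posDef_unit {k n : ℕ} {C : Set (Matrix (Fin k) (Fin k) V)} {e : V}
    {x : Matrix (Fin n) (Fin n) V}
    (hx : ∀ φ : V →ₗ[ℂ] Matrix (Fin k) (Fin k) ℂ, φ e = 1 → IsKPosToMk k C φ →
      (flattenM (x.map ⇑φ)).PosSemidef)
    {ψ : V →ₗ[ℂ] Matrix (Fin k) (Fin k) ℂ} (hψ : IsKPosToMk k C ψ) (hψe : (ψ e).PosDef) :
    (flattenM (x.map ψ)).PosSemidef := by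
  obtain ⟨B, hB⟩ : ∃ B : Matrix (Fin k) (Fin k) ℂ, ψ e = B.conjTranspose * B :=
    CStarAlgebra.nonneg_iff_eq_star_mul_self.1 hψe.posSemidef.nonneg
  have hBu : IsUnit B.det := by
    have h := (Matrix.isUnit_iff_isUnit_det _).1 hψe.isUnit
    rw [hB, Matrix.det_mul] at h
    exact isUnit_of_mul_isUnit_right h
  have hBB : B * B⁻¹ = 1 := Matrix.mul_nonsing_inv B hBu
  have hBB' : B⁻¹ * B = 1 := Matrix.nonsing_inv_mul B hBu
  let φ : V →ₗ[ℂ] Matrix (Fin k) (Fin k) ℂ :=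
    LinearMap.mulRight ℂ B⁻¹ ∘ₗ LinearMap.mulLeft ℂ B⁻¹.conjTranspose ∘ₗ ψ
  have hφ : ∀ v, φ v = B⁻¹.conjTranspose * ψ v * B⁻¹ := fun v => rfl
  have hφx := hx φ (by
      rw [hφ, hB, ← mul_assoc, ← Matrix.conjTranspose_mul, hBB, Matrix.conjTranspose_one, one_mul,
        hBB])
    (fun z hz => by
      rw [show ⇑φ = fun v => B⁻¹.conjTranspose * ψ v * B⁻¹ from funext hφ, flattenM_conj]
      exact (hψ z hz).conjTranspose_mul_mul_same _)
  have hψφ : ⇑ψ = fun v => B.conjTranspose * φ v * B := funext fun v => by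
    rw [hφ, ← mul_assoc, ← mul_assoc, ← Matrix.conjTranspose_mul, hBB', mul_assoc, hBB',
      Matrix.conjTranspose_one, one_mul, mul_one]
  rw [hψφ, flattenM_conj]
  exact hφx.conjTranspose_mul_mul_same _

theorem mem_kMinCone_of_forall_state {k n : ℕ} (hk : 0 < k) {C : Set (Matrix (Fin k) (Fin k) V)}
    {e : V} (hC : IsKAOU k C e) {x : Matrix (Fin n) (Fin n) V} (hxs : star x = x)
    (hx : ∀ φ : V →ₗ[ℂ] Matrix (Fin k) (Fin k) ℂ, φ e = 1 → IsKPosToMk k C φ →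
      (flattenM (x.map ⇑φ)).PosSemidef) :
    x ∈ kMinCone k C n := by
  refine ⟨hxs, fun α => ?_⟩
  by_contra hα
  obtain ⟨f, hf, hfu, hfα⟩ :=
    hC.exists_positive_functional_neg (by rw [star_conjAct, hxs]) hα
  let g : Matrix (Fin k) (Fin k) V →ₗ[ℂ] ℂ :=
    { toFun := fun z => f (unitMat k z.trace)
      map_add' := fun z w => by
        rw [← map_add]
        congr 1
        ext i j
        by_cases h : i = j <;> simp [unitMat, h]
      map_smul' := fun c z => by
        rw [RingHom.id_apply, ← map_smul]
        congr 1
        ext i j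
        by_cases h : i = j <;> simp [unitMat, h] }
  have hg : ∀ z ∈ C, 0 ≤ g z := fun z hz => hf _ (hC.unitMat_trace_mem hz)
  have hge : mapOfFunctional g e = 1 := by
    ext i j
    have h0 : unitMat k (0 : V) = 0 := by ext; simp [unitMat]
    by_cases h : i = j
    · subst h
      simp [mapOfFunctional, g, hfu]
    · simp [mapOfFunctional, g, h, h0]
  have nonneg : ∀ ε : ℝ, 0 < ε → 0 ≤ (f (conjAct α x)).re + ε * (g (conjAct α x)).re := by
    intro ε hε
    have hε' : (0 : ℂ) < (ε : ℂ) := by exact_mod_cast hε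
    have hfg : ∀ z ∈ C, 0 ≤ (f + (ε : ℂ) • g) z := fun z hz =>
      add_nonneg (hf z hz) (mul_nonneg hε'.le (hg z hz))
    have hunit : mapOfFunctional (f + (ε : ℂ) • g) e
        = mapOfFunctional f e + (ε : ℂ) • mapOfFunctional g e := by
      ext i j
      simp [mapOfFunctional]
    have h := (posSemidef_flattenM_of_posDef_unit hx (hC.isKPosToMk_mapOfFunctional hfg) (by
      rw [hunit, hge]
      exact Matrix.PosDef.posSemidef_add
        (hC.posSemidef_map_unit hk (hC.isKPosToMk_mapOfFunctional hf))
        (Matrix.PosDef.one.smul hε'))).dotProduct_mulVec_nonneg fun p => α p.1 p.2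
    rw [star_dotProduct_flattenM_mulVec, functionalOfMap_mapOfFunctional] at h
    change 0 ≤ (f + (ε : ℂ) • g) (conjAct α x) at h
    simpa using (Complex.nonneg_iff.1 h).1
  have hlim : Filter.Tendsto
      (fun ε : ℝ => (f (conjAct α x)).re + ε * (g (conjAct α x)).re)
      (nhdsWithin 0 (Set.Ioi 0)) (nhds (f (conjAct α x)).re) := by
    have hcont : Continuous fun ε : ℝ => (f (conjAct α x)).re + ε * (g (conjAct α x)).re := by
      fun_prop
    simpa using (hcont.tendsto 0).mono_left nhdsWithin_le_nhds
  exact hfα.not_ge (ge_of_tendsto hlim (Filter.eventually_of_mem self_mem_nhdsWithin nonneg))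

end KPositive


/-- For a hermitian `x ∈ M_n(V)` over a `k`-AOU space `(V, C, e)`, the
following are equivalent: `x ∈ C_n^{k-min}`; `φ_n(x)` is positive semidefinite for every
`k`-state `φ : V → M_k(ℂ)`; `ψ_n(x)` is positive semidefinite for every `k`-positive
`ψ : V → M_k(ℂ)`. -/
theorem stmt_5 {V : Type u} [AddCommGroup V] [Module ℂ V] [StarAddMonoid V] [StarModule ℂ V]
    (k : ℕ) (hk : 0 < k) (C : Set (Matrix (Fin k) (Fin k) V)) (e : V)
    (hC : IsKAOU k C e) (n : ℕ) (x : Matrix (Fin n) (Fin n) V) (hx : star x = x) :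
    (x ∈ kMinCone k C n ↔
      ∀ φ : V →ₗ[ℂ] Matrix (Fin k) (Fin k) ℂ, φ e = 1 → IsKPosToMk k C φ →
        (flattenM (x.map ⇑φ)).PosSemidef) ∧
    ((∀ φ : V →ₗ[ℂ] Matrix (Fin k) (Fin k) ℂ, φ e = 1 → IsKPosToMk k C φ →
        (flattenM (x.map ⇑φ)).PosSemidef) ↔
      ∀ ψ : V →ₗ[ℂ] Matrix (Fin k) (Fin k) ℂ, IsKPosToMk k C ψ →
        (flattenM (x.map ⇑ψ)).PosSemidef) := by
  have h12 := mem_kMinCone_of_forall_state hk hC hx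
  exact ⟨⟨fun h φ _ hφ => posSemidef_flattenM_of_mem_kMinCone h hφ, h12⟩,
    fun h ψ hψ => posSemidef_flattenM_of_mem_kMinCone (h12 h) hψ, fun h φ _ hφ => h φ hφ⟩
end
end
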